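/- Let f : S → ℂ be holomorphic on an open set S containing a smooth Jordan curve γ (the boundary of a Jordan domain G), with f' ≠ 0 on G, f locally univalent on the closure of G, and f injective on γ. Then f is injective on G. -/

import Mathlib

open Complex Metric

/-- A continuous nonvanishing function on the plane cannot agree with `z - p` near infinity. -/
lemma no_ext (V : Set ℂ) (hV : Bornology.IsBounded V) (p : ℂ) (h : ℂ → ℂ) (hc : Continuous h)
    (h0 : ∀ z, h z ≠ 0) (hh : ∀ z ∉ V, h z = z - p) : False := by
  obtain ⟨R, hR, hVR⟩ := hV.subset_ball_lt 0 p
  have hlift := isCoveringMapOn_exp.existsUnique_continuousMap_lifts (A := ℂ) ⟨h, hc⟩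
    (a₀ := 0) (e₀ := log (h 0)) (by simp [exp_log (h0 0)]) (by simpa using h0)
  obtain ⟨F, ⟨-, hF⟩, -⟩ := hlift
  have hF' : ∀ z, exp (F z) = h z := fun z => congrFun hF z
  have hcirc : ∀ t : ℝ, h (p + R * exp (t * I)) = R * exp (t * I) := by
    intro t
    rw [hh]
    · ring
    · intro hm
      have := hVR hm
      simp [Complex.norm_exp_ofReal_mul_I, abs_of_pos hR] at this
  let g : C(ℝ, ℂ) := ⟨fun t => R * exp (t * I), by fun_prop⟩
  have hu := isCoveringMapOn_exp.existsUnique_continuousMap_lifts (A := ℝ) g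
    (a₀ := 0) (e₀ := F (p + R)) (by
      have := hcirc 0
      rw [hF']
      simpa [g] using this) (by simp [g, hR.ne'])
  have h1 := hu.unique (y₁ := ⟨fun t => F (p + R * exp (t * I)), by fun_prop⟩)
    (y₂ := ⟨fun t => F (p + R) + t * I, by fun_prop⟩)
    ⟨by simp, by
      funext t
      simp [g, hF', hcirc]⟩
    ⟨by simp, by
      funext t
      have := hcirc 0
      simp only [ofReal_zero, zero_mul, exp_zero, mul_one] at this
      simp [g, exp_add, hF', this]⟩
  have h2 := congrArg (fun k : C(ℝ, ℂ) => k (2 * Real.pi)) h1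
  simp [Complex.exp_two_pi_mul_I, Real.pi_ne_zero] at h2

lemma no_sep (V : Set ℂ) (hV : Bornology.IsBounded V) (hVo : IsOpen V) (p : ℂ) (hp : p ∈ V)
    (ψ : ℝ → ℂ) (hψ : Continuous ψ) (hψp : ∀ t, ψ t ≠ p) (s : ℂ → ℝ) (hs : Continuous s)
    (hψs : ∀ z ∈ frontier V, ψ (s z) = z) : False := by
  classical
  refine no_ext V hV p (fun z => if z ∈ V then ψ (s z) - p else z - p) ?_ ?_ ?_
  · refine Continuous.if ?_ (by fun_prop) (by fun_prop)
    intro a ha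
    rw [hψs a ha]
  · intro z
    split_ifs with hz
    · exact sub_ne_zero.2 (hψp _)
    · refine sub_ne_zero.2 ?_
      rintro rfl
      exact hz hp
  · intro z hz
    simp [hz]

/-- The open image of `G` misses the injective image of the boundary curve. -/
lemma disj (G : Set ℂ) (φ : (sphere (0 : ℂ) 1) ≃ₜ (frontier G))
    (f : ℂ → ℂ) (hf : ContinuousOn f (frontier G)) (hbdinj : Set.InjOn f (frontier G))
    (V : Set ℂ) (hV : Bornology.IsBounded V) (hVo : IsOpen V)
    (hfr : frontier V ⊆ f '' frontier G) (z0 : ℂ) (hz0 : z0 ∈ frontier G) : f z0 ∉ V := by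
  intro hp
  set e : sphere (0 : ℂ) 1 → ℂ := fun x => f (φ x) with he
  have hec : Continuous e := by
    have : Continuous (fun y : frontier G => f y) := hf.domRestrict
    exact this.comp φ.continuous
  have hei : Function.Injective e := fun x y hxy =>
    φ.injective (Subtype.ext (hbdinj (φ x).2 (φ y).2 hxy))
  obtain ⟨c, hc⟩ : ∃ c, e c = f z0 := ⟨φ.symm ⟨z0, hz0⟩, by simp [he]⟩
  have hc1 : ‖(c : ℂ)‖ = 1 := by simpa using c.2
  have hc0 : (c : ℂ) ≠ 0 := by
    intro h
    simp [h] at hc1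
  let σ : ℝ → sphere (0 : ℂ) 1 := fun t => ⟨-c * exp ((2 * Real.arctan t : ℝ) * I), by
    rw [mem_sphere_zero_iff_norm, norm_mul, norm_exp_ofReal_mul_I, norm_neg, hc1, one_mul]⟩
  have hσ : Continuous σ := by
    refine Continuous.subtype_mk ?_ _
    have : Continuous Real.arctan := Real.continuous_arctan
    fun_prop
  let X := {x : sphere (0 : ℂ) 1 | e x ∈ frontier V}
  have hX : IsClosed X := isClosed_frontier.preimage hec
  haveI : CompactSpace X := isCompact_iff_compactSpace.1 hX.isCompact
  have hemb : Topology.IsClosedEmbedding (fun x : X => e x) :=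
    (hec.comp continuous_subtype_val).isClosedEmbedding (hei.comp Subtype.val_injective)
  have hnorm : ∀ x : sphere (0 : ℂ) 1, ‖-(x : ℂ) / c‖ = 1 := by
    intro x
    have : ‖(x : ℂ)‖ = 1 := by simpa using x.2
    simp [hc1]
  have hslit : ∀ x : X, -((x : sphere (0 : ℂ) 1) : ℂ) / c ∈ slitPlane := by
    intro x
    rw [mem_slitPlane_iff_arg]
    refine ⟨fun h => ?_, fun h => ?_⟩
    · have h2 := norm_mul_exp_arg_mul_I (-((x : sphere (0 : ℂ) 1) : ℂ) / c)
      rw [hnorm, h, exp_pi_mul_I] at h2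
      have h3 : ((x : sphere (0 : ℂ) 1) : ℂ) = c := by
        field_simp at h2
        simp at h2
        exact h2.symm
      have h4 : (x : sphere (0 : ℂ) 1) = c := Subtype.ext h3
      have h5 := x.2
      simp only [X, Set.mem_ofPred_eq] at h5
      rw [h4, hc, hVo.frontier_eq] at h5
      exact h5.2 hp
    · have := hnorm x
      rw [h] at this
      simp at this
  let s : X → ℝ := fun x => Real.tan (arg (-((x : sphere (0 : ℂ) 1) : ℂ) / c) / 2)
  have hlt : ∀ x : X, -(Real.pi / 2) < arg (-((x : sphere (0 : ℂ) 1) : ℂ) / c) / 2 ∧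
      arg (-((x : sphere (0 : ℂ) 1) : ℂ) / c) / 2 < Real.pi / 2 := by
    intro x
    have h1 := neg_pi_lt_arg (-((x : sphere (0 : ℂ) 1) : ℂ) / c)
    have h2 := lt_of_le_of_ne (arg_le_pi (-((x : sphere (0 : ℂ) 1) : ℂ) / c))
      (mem_slitPlane_iff_arg.1 (hslit x)).1
    constructor <;> linarith
  have hs : Continuous s := by
    rw [continuous_iff_continuousAt]
    intro x
    have h1 : ContinuousAt (fun x : X => arg (-((x : sphere (0 : ℂ) 1) : ℂ) / c) / 2) x := by
      refine ContinuousAt.div_const ?_ 2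
      refine ContinuousAt.comp (g := arg) (continuousAt_arg (hslit x)) ?_
      have : Continuous (fun x : X => -((x : sphere (0 : ℂ) 1) : ℂ) / c) := by fun_prop
      exact this.continuousAt
    exact ContinuousAt.comp (g := Real.tan)
      (Real.continuousAt_tan.2 (Real.cos_pos_of_mem_Ioo (hlt x)).ne') h1
  obtain ⟨g, hg⟩ := ContinuousMap.exists_extension' (Y := ℝ) hemb ⟨s, hs⟩
  refine no_sep V hV hVo (f z0) hp (fun t => e (σ t)) (hec.comp hσ) ?_ g g.continuous ?_
  · intro t ht
    rw [← hc] at ht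
    have h1 := congrArg Subtype.val (hei ht)
    simp only [σ] at h1
    have h2 : exp ((2 * Real.arctan t : ℝ) * I) = -1 := by
      have : (c : ℂ) * (exp ((2 * Real.arctan t : ℝ) * I) + 1) = 0 := by linear_combination -h1
      rcases mul_eq_zero.1 this with h | h
      · exact absurd h hc0
      · exact eq_neg_of_add_eq_zero_left h
    have h3 := Real.neg_pi_div_two_lt_arctan t
    have h4 := Real.arctan_lt_pi_div_two t
    have h5 := arg_exp_mul_I (2 * Real.arctan t)
    rw [(toIocMod_eq_self _).2 ⟨by linarith, by linarith⟩, h2, arg_neg_one] at h5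
    linarith
  · intro z hz
    obtain ⟨y, hy, rfl⟩ := hfr hz
    have hex : e (φ.symm ⟨y, hy⟩) = f y := by simp [he]
    let x : X := ⟨φ.symm ⟨y, hy⟩, by simpa only [X, Set.mem_ofPred_eq, hex] using hz⟩
    have h1 : g (f y) = s x := by
      have := congrFun hg x
      rw [← hex]
      exact this
    simp only [h1]
    rw [← hex]
    congr 1
    apply Subtype.ext
    change -(c : ℂ) * exp ((2 * Real.arctan (s x) : ℝ) * I) = ((x : sphere (0 : ℂ) 1) : ℂ)
    simp only [s]
    rw [Real.arctan_tan (hlt x).1 (hlt x).2, mul_div_cancel₀ _ (two_ne_zero)]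
    have h2 := norm_mul_exp_arg_mul_I (-((x : sphere (0 : ℂ) 1) : ℂ) / c)
    rw [hnorm, ofReal_one, one_mul] at h2
    rw [h2]
    field_simp

lemma loc_inj (f : ℂ → ℂ) (a : ℂ) (hf : AnalyticAt ℂ f a) (h : deriv f a ≠ 0) :
    ∃ U ∈ nhds a, Set.InjOn f U := by
  have h1 := hf.hasStrictDerivAt.hasStrictFDerivAt_equiv h
  exact ⟨_, (h1.toOpenPartialHomeomorph f).open_source.mem_nhds
    h1.mem_toOpenPartialHomeomorph_source, (h1.toOpenPartialHomeomorph f).injOn⟩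

theorem stmt19 (G : Set ℂ) (hG : IsOpen G) (hGconn : IsConnected G)
    (hGbd : Bornology.IsBounded G)
    (hJordan : Nonempty ((sphere (0 : ℂ) 1) ≃ₜ (frontier G)))
    (S : Set ℂ) (hS : IsOpen S) (hGS : closure G ⊆ S)
    (f : ℂ → ℂ) (hf : DifferentiableOn ℂ f S)
    (hf' : ∀ z ∈ G, deriv f z ≠ 0)
    (hbdinj : Set.InjOn f (frontier G)) :
    Set.InjOn f G := by
  obtain ⟨φ⟩ := hJordan
  have han : ∀ z ∈ closure G, AnalyticAt ℂ f z := fun z hz =>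
    hf.analyticAt (hS.mem_nhds (hGS hz))
  have hcont : ContinuousOn f (closure G) := hf.continuousOn.mono hGS
  have hK : IsCompact (closure G) := hGbd.isCompact_closure
  have hfrG : frontier G ⊆ closure G := frontier_subset_closure
  have hsplit : ∀ z ∈ closure G, z ∈ G ∨ z ∈ frontier G := by
    intro z hz
    by_cases h : z ∈ G
    · exact Or.inl h
    · right
      rw [hG.frontier_eq]
      exact ⟨hz, h⟩
  have hmap : ∀ z ∈ G, Filter.map f (nhds z) = nhds (f z) := fun z hz =>
    (han z (subset_closure hz)).hasStrictDerivAt.map_nhds_eq (hf' z hz)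
  have hVo : IsOpen (f '' G) := by
    rw [isOpen_iff_mem_nhds]
    rintro _ ⟨z, hz, rfl⟩
    rw [← hmap z hz]
    exact Filter.image_mem_map (hG.mem_nhds hz)
  have hKi : IsCompact (f '' closure G) := hK.image_of_continuousOn hcont
  have hVb : Bornology.IsBounded (f '' G) :=
    hKi.isBounded.subset (Set.image_mono subset_closure)
  have hfr : frontier (f '' G) ⊆ f '' frontier G := by
    intro w hw
    rw [hVo.frontier_eq] at hw
    obtain ⟨z, hz, rfl⟩ := closure_minimal (Set.image_mono subset_closure) hKi.isClosed hw.1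
    rcases hsplit z hz with h | h
    · exact absurd ⟨z, h, rfl⟩ hw.2
    · exact ⟨z, h, rfl⟩
  have hdisj : ∀ z ∈ frontier G, f z ∉ f '' G := fun z hz =>
    disj G φ f (hcont.mono hfrG) hbdinj _ hVb hVo hfr z hz
  -- a boundary point with nonvanishing derivative
  obtain ⟨z0, hz0, hd0⟩ : ∃ z ∈ frontier G, deriv f z ≠ 0 := by
    by_contra! hcon
    have hinf : (frontier G).Infinite := by
      rw [← Set.infinite_coe_iff, ← φ.toEquiv.infinite_iff, Set.infinite_coe_iff]
      have : Set.Infinite (Set.range fun t : ℝ => exp (Real.arctan t * I)) := by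
        refine Set.infinite_range_of_injective fun a b hab => ?_
        have ha := congrArg arg hab
        simp only [arg_exp_mul_I] at ha
        have h1 := Real.neg_pi_div_two_lt_arctan a
        have h2 := Real.arctan_lt_pi_div_two a
        have h3 := Real.neg_pi_div_two_lt_arctan b
        have h4 := Real.arctan_lt_pi_div_two b
        have hpi := Real.pi_pos
        rw [(toIocMod_eq_self _).2 ⟨by linarith, by linarith⟩,
          (toIocMod_eq_self _).2 ⟨by linarith, by linarith⟩] at ha
        exact Real.arctan_injective ha
      refine this.mono ?_
      rintro _ ⟨t, rfl⟩
      rw [mem_sphere_zero_iff_norm, norm_exp_ofReal_mul_I]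
    have hKf : IsCompact (frontier G) := hK.of_isClosed_subset isClosed_frontier hfrG
    obtain ⟨a, ha, hacc⟩ := hinf.exists_accPt_of_subset_isCompact hKf subset_rfl
    rw [accPt_iff_frequently_nhdsNE] at hacc
    have h1 := ((han a (hfrG ha)).deriv.frequently_zero_iff_eventually_zero).1
      (hacc.mono fun z hz => hcon z hz)
    have h2 := mem_closure_iff_frequently.1 (hfrG ha)
    obtain ⟨z, hz, hz'⟩ := (h2.and_eventually h1).exists
    exact hf' z hz hz'
  -- pairs of distinct points with the same image
  intro z1 hz1 z2 hz2 h12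
  by_contra hne
  let P : Set (ℂ × ℂ) := {q | q.1 ∈ G ∧ q.2 ∈ G ∧ q.1 ≠ q.2 ∧ f q.1 = f q.2}
  let B : Set ℂ := (fun q : ℂ × ℂ => f q.1) '' P
  have hPsub : P ⊆ closure G ×ˢ closure G := fun q hq =>
    ⟨subset_closure hq.1, subset_closure hq.2.1⟩
  have hPcl : closure P ⊆ closure G ×ˢ closure G :=
    closure_minimal hPsub (isClosed_closure.prod isClosed_closure)
  have hPcomp : IsCompact (closure P) :=
    (hK.prod hK).of_isClosed_subset isClosed_closure hPcl
  have hc1 : ContinuousOn (fun q : ℂ × ℂ => f q.1) (closure P) :=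
    hcont.comp continuousOn_fst fun q hq => (hPcl hq).1
  have hc2 : ContinuousOn (fun q : ℂ × ℂ => f q.2) (closure P) :=
    hcont.comp continuousOn_snd fun q hq => (hPcl hq).2
  have key : ∀ w ∈ closure B, ∃ a ∈ closure G, ∃ b ∈ closure G, f a = w ∧ f b = w ∧
      (a = b → deriv f a = 0) := by
    intro w hw
    have hcl : closure B ⊆ (fun q : ℂ × ℂ => f q.1) '' closure P :=
      closure_minimal (Set.image_mono subset_closure) (hPcomp.image_of_continuousOn hc1).isClosed
    obtain ⟨⟨a, b⟩, hab, rfl⟩ := hcl hw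
    have heq : f a = f b := by
      have : Set.EqOn (fun q : ℂ × ℂ => f q.1) (fun q : ℂ × ℂ => f q.2) (closure P) :=
        Set.EqOn.of_subset_closure (fun q hq => hq.2.2.2) hc1 hc2 subset_closure subset_rfl
      exact this hab
    refine ⟨a, (hPcl hab).1, b, (hPcl hab).2, rfl, heq.symm, ?_⟩
    rintro rfl
    by_contra hd
    obtain ⟨U, hU, hinj⟩ := loc_inj f a (han a (hPcl hab).1) hd
    obtain ⟨q, hqU, hqP⟩ := mem_closure_iff_nhds.1 hab (U ×ˢ U) (prod_mem_nhds hU hU)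
    exact hqP.2.2.1 (hinj hqU.1 hqU.2 hqP.2.2.2)
  have hBV : B ⊆ f '' G := by
    rintro _ ⟨q, hq, rfl⟩
    exact ⟨q.1, hq.1, rfl⟩
  have hBo : IsOpen B := by
    rw [isOpen_iff_mem_nhds]
    rintro _ ⟨⟨a, b⟩, ⟨ha, hb, hab, hfab⟩, rfl⟩
    obtain ⟨U, W, hU, hW, haU, hbW, hUW⟩ := t2_separation hab
    have h1 : f '' (G ∩ U) ∈ nhds (f a) := by
      rw [← hmap a ha]
      exact Filter.image_mem_map ((hG.inter hU).mem_nhds ⟨ha, haU⟩)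
    have h2 : f '' (G ∩ W) ∈ nhds (f a) := by
      simp only at hfab
      rw [hfab, ← hmap b hb]
      exact Filter.image_mem_map ((hG.inter hW).mem_nhds ⟨hb, hbW⟩)
    filter_upwards [h1, h2] with w hw1 hw2
    obtain ⟨x, hx, rfl⟩ := hw1
    obtain ⟨y, hy, hxy⟩ := hw2
    exact ⟨(x, y), ⟨hx.1, hy.1, hUW.ne_of_mem hx.2 hy.2, hxy.symm⟩, rfl⟩
  have hVB : f '' G ⊆ B := by
    have hVc : IsPreconnected (f '' G) :=
      hGconn.isPreconnected.image f (hcont.mono subset_closure)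
    refine hVc.subset_of_closure_inter_subset hBo ?_ ?_
    · exact ⟨f z1, ⟨z1, hz1, rfl⟩, (z1, z2), ⟨hz1, hz2, hne, h12⟩, rfl⟩
    · rintro w ⟨hwc, hwV⟩
      obtain ⟨a, ha, b, hb, rfl, hbw, hd⟩ := key w hwc
      have haG : a ∈ G := (hsplit a ha).resolve_right fun h => hdisj a h hwV
      have hbG : b ∈ G := (hsplit b hb).resolve_right fun h => hdisj b h (hbw ▸ hwV)
      exact ⟨(a, b), ⟨haG, hbG, fun h => hf' a haG (hd h), hbw.symm⟩, rfl⟩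
  have hw0 : f z0 ∈ closure B := by
    have h1 : f z0 ∈ closure (f '' G) :=
      (hcont z0 (hfrG hz0)).mono subset_closure |>.mem_closure_image (hfrG hz0)
    exact closure_mono hVB h1
  obtain ⟨a, ha, b, hb, haw, hbw, hd⟩ := key _ hw0
  have haz : a = z0 := by
    rcases hsplit a ha with h | h
    · exact absurd ⟨a, h, haw⟩ (hdisj z0 hz0)
    · exact hbdinj h hz0 haw
  have hbz : b = z0 := by
    rcases hsplit b hb with h | h
    · exact absurd ⟨b, h, hbw⟩ (hdisj z0 hz0)
    · exact hbdinj h hz0 hbw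
  rw [haz, hbz] at hd
  exact hd0 (hd rfl)
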